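/- Define on 𝔡 = 𝔤 × 𝔤 the bracket [a,b]' := (1/2)([r_𝔡 a, b] + [a, r_𝔡 b]), where [ , ] is the componentwise Lie bracket and r_𝔡 = P_δ − P_*. Then 𝔤^δ and ι(𝔤) are complementary ideals of (𝔡, [,]'): [δ(X), δ(Y)]' = δ([X,Y]) for all X,Y ∈ 𝔤 (where δ(X) = (X,X)); [ι(X), ι(Y)]' = −ι([X,Y]_*) for all X,Y ∈ 𝔤; and [δ(X), ι(Y)]' = 0 for all X,Y ∈ 𝔤. In particular (𝔡,[,]')/ι(𝔤) is isomorphic to 𝔤 and (𝔡,[,]')/𝔤^δ is anti-isomorphic to (𝔤, [,]_*). -/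

import Mathlib

/-- The r-bracket `[X, Y]_* = (1/2)([rX, Y] + [X, rY])`. -/
noncomputable def rBracket {k : Type*} [Field k] {L : Type*} [LieRing L] [LieAlgebra k L]
    (r : L →ₗ[k] L) (X Y : L) : L :=
  (2⁻¹ : k) • (⁅r X, Y⁆ + ⁅X, r Y⁆)

/-- `r_+ = (1/2)(r + id)`. -/
noncomputable def rPlus {k : Type*} [Field k] {L : Type*} [AddCommGroup L] [Module k L]
    (r : L →ₗ[k] L) : L →ₗ[k] L :=
  (2⁻¹ : k) • (r + LinearMap.id)

/-- `r_- = (1/2)(r - id)`. -/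
noncomputable def rMinus {k : Type*} [Field k] {L : Type*} [AddCommGroup L] [Module k L]
    (r : L →ₗ[k] L) : L →ₗ[k] L :=
  (2⁻¹ : k) • (r - LinearMap.id)

/-- The componentwise Lie bracket on the product `𝔤 × 𝔤`. -/
def prodBracket {L : Type*} [LieRing L] (a b : L × L) : L × L :=
  (⁅a.1, b.1⁆, ⁅a.2, b.2⁆)

section

variable {k : Type*} [Field k]

theorem rPlus_sub_rMinus [CharZero k] {L : Type*} [AddCommGroup L] [Module k L]
    (r : L →ₗ[k] L) (X : L) : rPlus r X - rMinus r X = X := by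
  simp only [rPlus, rMinus, LinearMap.smul_apply, LinearMap.add_apply, LinearMap.sub_apply,
    LinearMap.id_apply]
  module

/-- The diagonal and the image of `ι` meet only in `0`. -/
theorem eq_zero_of_rPlus_eq_rMinus [CharZero k] {L : Type*} [AddCommGroup L] [Module k L]
    {r : L →ₗ[k] L} {X : L} (h : rPlus r X = rMinus r X) : X = 0 := by
  rw [← rPlus_sub_rMinus r X, h, sub_self]

variable {L : Type*} [LieRing L] [LieAlgebra k L] {r : L →ₗ[k] L}

theorem lie_rPlus_rPlus
    (hr : ∀ X Y : L, ⁅r X, r Y⁆ = r (⁅r X, Y⁆ + ⁅X, r Y⁆) - ⁅X, Y⁆) (X Y : L) :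
    ⁅rPlus r X, rPlus r Y⁆ = rPlus r (rBracket r X Y) := by
  simp only [rPlus, rBracket, LinearMap.smul_apply, LinearMap.add_apply, LinearMap.id_apply,
    smul_lie, lie_smul, add_lie, lie_add, hr, map_smul, map_add]
  module

theorem lie_rMinus_rMinus
    (hr : ∀ X Y : L, ⁅r X, r Y⁆ = r (⁅r X, Y⁆ + ⁅X, r Y⁆) - ⁅X, Y⁆) (X Y : L) :
    ⁅rMinus r X, rMinus r Y⁆ = rMinus r (rBracket r X Y) := by
  simp only [rMinus, rBracket, LinearMap.smul_apply, LinearMap.sub_apply, LinearMap.id_apply,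
    smul_lie, lie_smul, sub_lie, lie_sub, hr, map_smul, map_add]
  module

end

/-- On `𝔡 = 𝔤 × 𝔤` define `[a,b]' = (1/2)([r_𝔡 a, b] + [a, r_𝔡 b])` with
`r_𝔡 = Pδ − P⋆`.  Then the diagonal `𝔤^δ` and `ι(𝔤)` are complementary ideals of
`(𝔡, [,]')`:  `[δX, δY]' = δ[X,Y]`, `[ιX, ιY]' = −ι([X,Y]_*)` and `[δX, ιY]' = 0`.
In particular `(𝔡,[,]')/ι(𝔤)` is isomorphic to `𝔤` and `(𝔡,[,]')/𝔤^δ` is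
anti-isomorphic to `(𝔤, [,]_*)`. -/
theorem double_bracket_on_diagonal_and_iota {k : Type*} [Field k] [CharZero k]
    {L : Type*} [LieRing L] [LieAlgebra k L] (r : L →ₗ[k] L)
    (hmcybe : ∀ X Y : L, ⁅r X, r Y⁆ = r (⁅r X, Y⁆ + ⁅X, r Y⁆) - ⁅X, Y⁆)
    (Pδ Pstar : (L × L) →ₗ[k] (L × L))
    (hsum : ∀ v : L × L, Pδ v + Pstar v = v)
    (hPδ : ∀ v : L × L, ∃ Z : L, Pδ v = (Z, Z))
    (hPstar : ∀ v : L × L, ∃ W : L, Pstar v = (rPlus r W, rMinus r W)) :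
    (∀ X Y : L,
      (2⁻¹ : k) • (prodBracket ((Pδ - Pstar) (X, X)) (Y, Y) +
          prodBracket (X, X) ((Pδ - Pstar) (Y, Y))) =
        ((⁅X, Y⁆, ⁅X, Y⁆) : L × L)) ∧
    (∀ X Y : L,
      (2⁻¹ : k) • (prodBracket ((Pδ - Pstar) (rPlus r X, rMinus r X)) (rPlus r Y, rMinus r Y) +
          prodBracket (rPlus r X, rMinus r X) ((Pδ - Pstar) (rPlus r Y, rMinus r Y))) =
        -((rPlus r (rBracket r X Y), rMinus r (rBracket r X Y)) : L × L)) ∧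
    (∀ X Y : L,
      (2⁻¹ : k) • (prodBracket ((Pδ - Pstar) (X, X)) (rPlus r Y, rMinus r Y) +
          prodBracket (X, X) ((Pδ - Pstar) (rPlus r Y, rMinus r Y))) = 0) := by
  have hδ : ∀ X : L, (Pδ - Pstar) (X, X) = (X, X) := by
    intro X
    obtain ⟨Z, hZ⟩ := hPδ (X, X)
    obtain ⟨W, hW⟩ := hPstar (X, X)
    have h := hsum (X, X)
    rw [hZ, hW, Prod.mk_add_mk, Prod.mk.injEq] at h
    have hW0 : W = 0 :=
      eq_zero_of_rPlus_eq_rMinus (add_left_cancel (h.1.trans h.2.symm))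
    simp only [hW0, map_zero, add_zero] at h
    rw [LinearMap.sub_apply, hZ, hW, hW0, h.1]
    simp
  have hι : ∀ Y : L, (Pδ - Pstar) (rPlus r Y, rMinus r Y) = -(rPlus r Y, rMinus r Y) := by
    intro Y
    obtain ⟨Z, hZ⟩ := hPδ (rPlus r Y, rMinus r Y)
    obtain ⟨W, hW⟩ := hPstar (rPlus r Y, rMinus r Y)
    have h := hsum (rPlus r Y, rMinus r Y)
    rw [hZ, hW, Prod.mk_add_mk, Prod.mk.injEq, ← eq_sub_iff_add_eq, ← eq_sub_iff_add_eq,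
      ← map_sub, ← map_sub] at h
    have hYW : Y - W = 0 := eq_zero_of_rPlus_eq_rMinus (h.1.symm.trans h.2)
    rw [hYW, map_zero] at h
    rw [LinearMap.sub_apply, hZ, hW, h.1, sub_eq_zero.mp hYW]
    simp
  refine ⟨fun X Y => ?_, fun X Y => ?_, fun X Y => ?_⟩
  · rw [hδ, hδ]
    simp only [prodBracket]
    module
  · rw [hι, hι]
    simp only [prodBracket, Prod.fst_neg, Prod.snd_neg, neg_lie, lie_neg,
      lie_rPlus_rPlus hmcybe, lie_rMinus_rMinus hmcybe, ← Prod.neg_mk]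
    module
  · rw [hδ, hι]
    simp only [prodBracket, Prod.fst_neg, Prod.snd_neg, lie_neg, Prod.mk_add_mk, add_neg_cancel,
      Prod.mk_zero_zero, smul_zero]
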